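/- arXiv:1302.4147 — 5 statements merged into one kernel-verified Lean document; each statement's English description precedes it below -/
import Mathlib

section
/- Let V be an n-dimensional vector space over a finite field F, let L0 and L1 be subspaces of V with dim L0 = k0 such that L0 + L1 = V. If l_1, ..., l_{n-k0} are drawn independently and uniformly at random from L1 (i.e., according to the uniform probability measure on the finite set L1^{n-k0}), then the probability that the span of L0 together with {l_1, ..., l_{n-k0}} equals V (equivalently, has dimension n) is exactly ∏_{i=1}^{n-k0} (1 - 1/|F|^i). -/
/-- All fibres of a surjective homomorphism are translates of its kernel. -/
theorem AddMonoidHom.card_subtype_comp_of_surjective {G H : Type*} [AddGroup G] [AddGroup H]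
    (f : G →+ H) (hf : Function.Surjective f) (p : H → Prop) :
    Nat.card {x // p (f x)} = Nat.card f.ker * Nat.card {y // p y} := by
  obtain ⟨s, hs⟩ := hf.hasRightInverse
  rw [mul_comm, ← Nat.card_prod]
  refine Nat.card_congr
    { toFun := fun x => (⟨f x, x.2⟩, ⟨x - s (f x), by simp [AddMonoidHom.mem_ker, hs (f x)]⟩)
      invFun := fun z => ⟨z.2 + s z.1, by
        simpa [AddMonoidHom.mem_ker.mp z.2.2, hs z.1.1] using z.1.2⟩
      left_inv := fun x => by simp
      right_inv := fun z => ?_ }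
  have h : f (z.2 + s z.1) = z.1 := by simp [AddMonoidHom.mem_ker.mp z.2.2, hs z.1.1]
  ext <;> simp [h]

/-- The images of a uniformly random family of vectors of `M` under a surjective linear map `M → Q`
form a uniformly random family of vectors of `Q`. -/
theorem LinearMap.card_comp_div_card_pow_of_surjective {F M Q ι : Type*} [Ring F]
    [AddCommGroup M] [Module F M] [Finite M] [AddCommGroup Q] [Module F Q] [Fintype ι]
    (f : M →ₗ[F] Q) (hf : Function.Surjective f) (p : (ι → Q) → Prop) :
    (Nat.card {v : ι → M // p (fun i => f (v i))} : ℝ) / (Nat.card M : ℝ) ^ Fintype.card ι =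
      (Nat.card {w : ι → Q // p w} : ℝ) / (Nat.card Q : ℝ) ^ Fintype.card ι := by
  let g : (ι → M) →+ (ι → Q) := (f.compLeft ι).toAddMonoidHom
  have hg : Function.Surjective g := hf.comp_left
  have hcard (p : (ι → Q) → Prop) : Nat.card {v : ι → M // p (fun i => f (v i))} =
      Nat.card g.ker * Nat.card {w // p w} := g.card_subtype_comp_of_surjective hg p
  have htotal : Nat.card M ^ Fintype.card ι = Nat.card g.ker * Nat.card Q ^ Fintype.card ι := by
    have h := hcard fun _ => True
    rwa [Nat.card_congr (Equiv.subtypeUnivEquiv fun _ => trivial),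
      Nat.card_congr (Equiv.subtypeUnivEquiv fun _ => trivial), Nat.card_fun, Nat.card_fun,
      Nat.card_eq_fintype_card (α := ι)] at h
  have hker : (Nat.card g.ker : ℝ) ≠ 0 := Nat.cast_ne_zero.mpr Nat.card_pos.ne'
  rw [hcard p, ← Nat.cast_pow, htotal]
  push_cast
  exact mul_div_mul_left _ _ hker

/-- A uniformly random family of `dim Q` vectors of `Q` is a basis with probability
`∏_{i=1}^{dim Q} (1 - 1/|F|^i)`. -/
theorem card_span_eq_top_div_card_pow {F Q : Type*} [Field F] [Fintype F] [AddCommGroup Q]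
    [Module F Q] [FiniteDimensional F Q] {m : ℕ} (hm : Module.finrank F Q = m) :
    (Nat.card {w : Fin m → Q // Submodule.span F (Set.range w) = ⊤} : ℝ) /
        (Nat.card Q : ℝ) ^ m =
      ∏ i ∈ Finset.range m, (1 - 1 / (Fintype.card F : ℝ) ^ (i + 1)) := by
  have : Finite Q := Module.finite_of_finite F
  have : Fintype Q := Fintype.ofFinite Q
  have hspan (w : Fin m → Q) :
      Submodule.span F (Set.range w) = ⊤ ↔ LinearIndependent F w := by
    have hc : Fintype.card (Fin m) = Module.finrank F Q := by simp [hm]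
    exact ⟨fun h => linearIndependent_of_top_le_span_of_card_eq_finrank h.ge hc,
      fun h => h.span_eq_top_of_card_eq_finrank' hc⟩
  simp_rw [hspan]
  rw [card_linearIndependent hm.ge, hm, Nat.card_eq_fintype_card,
    Module.card_eq_pow_finrank (K := F) (V := Q), hm,
    Fin.prod_univ_eq_prod_range (fun i => Fintype.card F ^ m - Fintype.card F ^ i),
    ← Finset.prod_range_reflect (fun i => 1 - 1 / (Fintype.card F : ℝ) ^ (i + 1)), Nat.cast_prod,
    Finset.pow_eq_prod_const ((Fintype.card F ^ m : ℕ) : ℝ), ← Finset.prod_div_distrib]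
  refine Finset.prod_congr rfl fun i hi => ?_
  have hi := Finset.mem_range.mp hi
  rw [Nat.cast_sub (Nat.pow_le_pow_right Fintype.card_pos hi.le)]
  have h : (Fintype.card F : ℝ) ^ m =
      (Fintype.card F : ℝ) ^ i * (Fintype.card F : ℝ) ^ (m - 1 - i + 1) := by
    rw [← pow_add]
    congr 1
    omega
  push_cast
  rw [h]
  field_simp

/-- Lemma 1: if `L0` and `L1` are subspaces of an `n`-dimensional space `V` over a finite
field `F` with `dim L0 = k0` and `L0 + L1 = V`, and `n - k0` vectors are drawn independently
and uniformly from `L1`, then the probability (number of favorable tuples divided by the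
total number `|L1|^(n-k0)` of tuples) that they span `V` together with `L0` is
`∏_{i=1}^{n-k0} (1 - 1/|F|^i)`. -/
theorem uniform_random_vectors_span_prob
    (F : Type*) [Field F] [Fintype F]
    (V : Type*) [AddCommGroup V] [Module F V] [FiniteDimensional F V]
    (n k0 : ℕ) (hn : Module.finrank F V = n)
    (L0 L1 : Submodule F V) (hk0 : Module.finrank F L0 = k0)
    (hsup : L0 ⊔ L1 = ⊤) :
    (Nat.card {v : Fin (n - k0) → L1 //
        L0 ⊔ Submodule.span F (Set.range (fun i => (v i : V))) = ⊤} : ℝ) /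
      (Nat.card L1 : ℝ) ^ (n - k0) =
    ∏ i ∈ Finset.range (n - k0), (1 - 1 / (Fintype.card F : ℝ) ^ (i + 1)) := by
  have : Finite V := Module.finite_of_finite F
  let f : L1 →ₗ[F] V ⧸ L0 := L0.mkQ.comp L1.subtype
  have hf : Function.Surjective f := by
    rw [← LinearMap.range_eq_top, LinearMap.range_comp, Submodule.range_subtype,
      Submodule.map_mkQ_eq_top, hsup]
  have hspan (v : Fin (n - k0) → L1) :
      L0 ⊔ Submodule.span F (Set.range (fun i => (v i : V))) = ⊤ ↔
        Submodule.span F (Set.range (fun i => f (v i))) = ⊤ := by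
    rw [← Submodule.map_mkQ_eq_top, Submodule.map_span, ← Set.range_comp]
    rfl
  have hdim : Module.finrank F (V ⧸ L0) = n - k0 := by
    rw [Submodule.finrank_quotient, hn, hk0]
  simp_rw [hspan]
  rw [← card_span_eq_top_div_card_pow hdim]
  simpa using f.card_comp_div_card_pow_of_surjective hf
    fun w : Fin (n - k0) → V ⧸ L0 => Submodule.span F (Set.range w) = ⊤
end

section
/- Let V be an n-dimensional vector space over a finite field F, let L0 and L1 be subspaces of V with dim L0 = k0 such that L0 + L1 = V. Then the number of tuples (l_1, ..., l_{n-k0}) ∈ L1^{n-k0} such that L0 + span{l_1, ..., l_{n-k0}} = V equals |L1|^{n-k0} · ∏_{i=1}^{n-k0} (1 - 1/|F|^i) (in particular this quantity is a natural number). -/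
/-- The preimage of a set under a surjective homomorphism has the same density as the set. -/
theorem AddMonoidHom.card_subtype_comp_mul_card {A B : Type*} [AddCommGroup A] [AddCommGroup B]
    (f : A →+ B) (hf : Function.Surjective f) (P : B → Prop) :
    Nat.card {a // P (f a)} * Nat.card B = Nat.card A * Nat.card {b // P b} := by
  have hg := Function.surjInv_eq hf
  let e : A ≃ B × f.ker :=
    { toFun := fun a => (f a, ⟨a - Function.surjInv hf (f a), by simp [AddMonoidHom.mem_ker, hg]⟩)
      invFun := fun x => Function.surjInv hf x.1 + x.2
      left_inv := fun a => by simp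
      right_inv := fun ⟨b, c, hc⟩ => by
        rw [AddMonoidHom.mem_ker] at hc
        simp [hg, hc] }
  have hP : Nat.card {a // P (f a)} = Nat.card {b // P b} * Nat.card f.ker := by
    rw [← Nat.card_prod]
    exact Nat.card_congr ((e.subtypeEquiv (q := fun x => P x.1) fun _ => Iff.rfl).trans
      Equiv.prodSubtypeFstEquivSubtypeProd)
  rw [hP, Nat.card_congr e, Nat.card_prod]
  ring

/-- The number of spanning families of `finrank F W` vectors in `W`. -/
theorem card_span_range_eq_top {F W : Type*} [Field F] [Fintype F] [AddCommGroup W] [Module F W]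
    [FiniteDimensional F W] {m : ℕ} (hm : Module.finrank F W = m) :
    (Nat.card {w : Fin m → W // Submodule.span F (Set.range w) = ⊤} : ℝ) =
      (Nat.card W : ℝ) ^ m * ∏ i ∈ Finset.range m, (1 - 1 / (Fintype.card F : ℝ) ^ (i + 1)) := by
  have : Finite W := Module.finite_of_finite F
  have hq : (Fintype.card F : ℝ) ≠ 0 := by simp
  have hli (w : Fin m → W) :
      Submodule.span F (Set.range w) = ⊤ ↔ LinearIndependent F w :=
    ⟨fun h => linearIndependent_of_top_le_span_of_card_eq_finrank h.ge (by simp [hm]),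
      fun h => h.span_eq_top_of_card_eq_finrank' (by simp [hm])⟩
  simp_rw [hli]
  rw [card_linearIndependent hm.ge, Module.natCard_eq_pow_finrank (K := F), hm,
    Nat.card_eq_fintype_card, Fin.prod_univ_eq_prod_range
      (fun i => Fintype.card F ^ m - Fintype.card F ^ i), ← Finset.prod_range_reflect]
  push_cast
  rw [show ((Fintype.card F : ℝ) ^ m) ^ m = ∏ _i ∈ Finset.range m, (Fintype.card F : ℝ) ^ m by simp,
    ← Finset.prod_mul_distrib]
  refine Finset.prod_congr rfl fun i hi => ?_
  have hi := Finset.mem_range.mp hi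
  rw [Nat.cast_sub (Nat.pow_le_pow_right Fintype.card_pos (by omega))]
  obtain ⟨j, rfl⟩ := Nat.exists_eq_add_of_lt hi
  rw [show i + j + 1 - 1 - i = j by omega]
  push_cast
  field_simp
  ring

/-- Counting form of Lemma 1: the number of tuples `(l_1, ..., l_{n-k0}) ∈ L1^{n-k0}` such
that `L0 + span{l_1, ..., l_{n-k0}} = V` equals `|L1|^(n-k0) · ∏_{i=1}^{n-k0} (1 - 1/|F|^i)`. -/
theorem count_spanning_tuples
    (F : Type*) [Field F] [Fintype F]
    (V : Type*) [AddCommGroup V] [Module F V] [FiniteDimensional F V]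
    (n k0 : ℕ) (hn : Module.finrank F V = n)
    (L0 L1 : Submodule F V) (hk0 : Module.finrank F L0 = k0)
    (hsup : L0 ⊔ L1 = ⊤) :
    (Nat.card {v : Fin (n - k0) → L1 //
        L0 ⊔ Submodule.span F (Set.range (fun i => (v i : V))) = ⊤} : ℝ) =
    (Nat.card L1 : ℝ) ^ (n - k0) *
      ∏ i ∈ Finset.range (n - k0), (1 - 1 / (Fintype.card F : ℝ) ^ (i + 1)) := by
  have : Finite (V ⧸ L0) := Module.finite_of_finite F
  let p : L1 →ₗ[F] V ⧸ L0 := L0.mkQ ∘ₗ L1.subtype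
  have hp : Function.Surjective p := by
    rw [← LinearMap.range_eq_top, LinearMap.range_comp, Submodule.range_subtype,
      Submodule.map_mkQ_eq_top, hsup]
  have hW : Module.finrank F (V ⧸ L0) = n - k0 := by
    rw [Submodule.finrank_quotient, hn, hk0]
  have hspan (v : Fin (n - k0) → L1) :
      L0 ⊔ Submodule.span F (Set.range fun i => (v i : V)) = ⊤ ↔
        Submodule.span F (Set.range (p.compLeft (Fin (n - k0)) v)) = ⊤ := by
    rw [← Submodule.map_mkQ_eq_top, Submodule.map_span, ← Set.range_comp]
    rfl
  have hcard := AddMonoidHom.card_subtype_comp_mul_card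
    (p.compLeft (Fin (n - k0))).toAddMonoidHom hp.comp_left
    (fun w => Submodule.span F (Set.range w) = ⊤)
  rw [Nat.card_fun, Nat.card_fun, Nat.card_fin] at hcard
  have hcard' := congrArg (Nat.cast : ℕ → ℝ) hcard
  push_cast at hcard'
  rw [card_span_range_eq_top hW] at hcard'
  simp_rw [hspan]
  have hne : (Nat.card (V ⧸ L0) : ℝ) ^ (n - k0) ≠ 0 :=
    pow_ne_zero _ (Nat.cast_ne_zero.mpr Nat.card_pos.ne')
  refine mul_right_cancel₀ hne (hcard'.trans ?_)
  ring
end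

section
/- Let F be a finite field with q elements, and let w and n be integers with 1 ≤ w ≤ n. If M is drawn uniformly at random from the set of all w×n matrices over F, then the probability that rank(M) < w is at least q^{-(n-w+1)}. -/
theorem Matrix.rank_lt_card_iff_not_linearIndependent_row {F m n : Type*} [Field F] [Fintype m]
    [Fintype n] (M : Matrix m n F) :
    M.rank < Fintype.card m ↔ ¬ LinearIndependent F M.row := by
  rw [linearIndependent_iff_card_le_finrank_span, Set.finrank, ← M.rank_eq_finrank_span_row,
    not_le]

theorem card_linearIndependent_succ_le {K V : Type*} [DivisionRing K] [AddCommGroup V]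
    [Module K V] [Fintype K] [Finite V] {k : ℕ} (hk : k + 1 ≤ Module.finrank K V) :
    Nat.card {s : Fin (k + 1) → V // LinearIndependent K s} ≤
      (Fintype.card K ^ Module.finrank K V) ^ k *
        (Fintype.card K ^ Module.finrank K V - Fintype.card K ^ k) := by
  rw [card_linearIndependent hk, Fin.prod_univ_castSucc]
  refine Nat.mul_le_mul ?_ le_rfl
  refine (Finset.prod_le_pow_card _ _ _ fun i _ => Nat.sub_le _ _).trans_eq ?_
  rw [Finset.card_univ, Fintype.card_fin]

/-- If `M` is drawn uniformly at random from the `w×n` matrices over a finite field with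
`q` elements, where `1 ≤ w ≤ n`, then the probability that `rank(M) < w` is at least
`q^{-(n-w+1)}`. -/
theorem prob_rank_deficient_ge
    (F : Type*) [Field F] [Fintype F] (q : ℕ) (hq : Fintype.card F = q)
    (w n : ℕ) (hw : 1 ≤ w) (hwn : w ≤ n) :
    ((q : ℝ) ^ (n - w + 1))⁻¹ ≤
      (Nat.card {M : Matrix (Fin w) (Fin n) F // M.rank < w} : ℝ) /
        (Nat.card (Matrix (Fin w) (Fin n) F) : ℝ) := by
  classical
  obtain ⟨k, rfl⟩ := Nat.exists_eq_add_of_le' hw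
  obtain ⟨d, rfl⟩ := Nat.exists_eq_add_of_le hwn
  have hq0 : 0 < q := hq ▸ Fintype.card_pos
  have hli := card_linearIndependent_succ_le (K := F) (V := Fin (k + 1 + d) → F) (k := k)
    (by simp)
  rw [Module.finrank_fin_fun, hq] at hli
  have htotal : Nat.card (Matrix (Fin (k + 1)) (Fin (k + 1 + d)) F) =
      (q ^ (k + 1 + d)) ^ k * q ^ (k + 1 + d) := by
    rw [← pow_succ, Matrix, Nat.card_fun, Nat.card_fun]
    simp [hq]
  have hsplit : Nat.card {M : Matrix (Fin (k + 1)) (Fin (k + 1 + d)) F // M.rank < k + 1} +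
      Nat.card {s : Fin (k + 1) → Fin (k + 1 + d) → F // LinearIndependent F s} =
      Nat.card (Matrix (Fin (k + 1)) (Fin (k + 1 + d)) F) := by
    rw [add_comm, ← Nat.card_congr (Equiv.sumCompl fun M : Matrix (Fin (k + 1))
      (Fin (k + 1 + d)) F => LinearIndependent F M.row), Nat.card_sum]
    congr 1
    refine Nat.card_congr (Equiv.subtypeEquivRight fun M => ?_)
    simpa using M.rank_lt_card_iff_not_linearIndependent_row
  have hdef : (q ^ (k + 1 + d)) ^ k * q ^ k ≤
      Nat.card {M : Matrix (Fin (k + 1)) (Fin (k + 1 + d)) F // M.rank < k + 1} := by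
    have hpow : q ^ k ≤ q ^ (k + 1 + d) := Nat.pow_le_pow_right hq0 (by omega)
    rw [Nat.mul_sub] at hli
    have := Nat.mul_le_mul_left ((q ^ (k + 1 + d)) ^ k) hpow
    omega
  have hqR : (0 : ℝ) < q := by exact_mod_cast hq0
  rw [htotal, le_div_iff₀ (by positivity)]
  refine le_trans (le_of_eq ?_) (Nat.cast_le.2 hdef)
  rw [Nat.add_sub_cancel_left, inv_mul_eq_iff_eq_mul₀ (by positivity)]
  push_cast
  ring
end

section
/- Let l ≥ 1 and R ≥ 1 be integers and let a be a real number with 0 ≤ a ≤ 1/l. Let c_1, ..., c_R be integers with 0 ≤ c_k ≤ l for each k, and suppose Σ_{k=1}^{R} c_k = l·b + u where b, u are nonnegative integers with 0 ≤ u ≤ l-1. Then ∏_{k=1}^{R} (1 - c_k·a) ≥ (1 - l·a)^{b} · (1 - u·a). -/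
/-- Adding `c ≤ l` to `n` costs the extremal product at most a factor `1 - c * a`. -/
lemma pow_div_mul_one_sub_mod_add_le {l c : ℕ} (hl : 0 < l) (hc : c ≤ l) {a : ℝ} (ha : 0 ≤ a)
    (hla : (l : ℝ) * a ≤ 1) (n : ℕ) :
    (1 - (l : ℝ) * a) ^ ((c + n) / l) * (1 - ((c + n) % l : ℕ) * a) ≤
      (1 - (c : ℝ) * a) * ((1 - (l : ℝ) * a) ^ (n / l) * (1 - (n % l : ℕ) * a)) := by
  have hpow : 0 ≤ (1 - (l : ℝ) * a) ^ (n / l) := pow_nonneg (by linarith) _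
  have hr : n % l < l := Nat.mod_lt n hl
  have hn : l * (n / l) + n % l = n := Nat.div_add_mod n l
  generalize n / l = q at *
  generalize n % l = r at *
  rcases lt_or_ge (c + r) l with h | h
  · obtain ⟨hq, hm⟩ : (c + n) / l = q ∧ (c + n) % l = c + r :=
      (Nat.div_mod_unique hl).2 ⟨by lia, h⟩
    rw [hq, hm]
    have key : 1 - ((c + r : ℕ) : ℝ) * a ≤ (1 - (c : ℝ) * a) * (1 - (r : ℝ) * a) := by
      have : 0 ≤ ((c : ℝ) * a) * ((r : ℝ) * a) := by positivity
      push_cast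
      linarith
    linarith [mul_le_mul_of_nonneg_left key hpow]
  · obtain ⟨u, hu⟩ := Nat.exists_eq_add_of_le h
    obtain ⟨hq, hm⟩ : (c + n) / l = q + 1 ∧ (c + n) % l = u :=
      (Nat.div_mod_unique hl).2 ⟨by rw [mul_add]; lia, by lia⟩
    rw [hq, hm, pow_succ]
    have key : (1 - (l : ℝ) * a) * (1 - (u : ℝ) * a) ≤
        (1 - (c : ℝ) * a) * (1 - (r : ℝ) * a) := by
      have hu' : (u : ℝ) = c + r - l := by
        rw [eq_sub_iff_add_eq']
        exact_mod_cast hu.symm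
      have hcl : (0 : ℝ) ≤ l - c := sub_nonneg.2 (by exact_mod_cast hc)
      have hrl : (0 : ℝ) ≤ l - r := sub_nonneg.2 (by exact_mod_cast hr.le)
      have : 0 ≤ ((l : ℝ) - c) * (l - r) * a ^ 2 := by positivity
      rw [hu']
      linarith
    linarith [mul_le_mul_of_nonneg_left key hpow]

lemma pow_div_mul_one_sub_mod_sum_le_prod {ι : Type*} (s : Finset ι) {l : ℕ} (hl : 0 < l)
    {c : ι → ℕ} (hc : ∀ k, c k ≤ l) {a : ℝ} (ha : 0 ≤ a) (hla : (l : ℝ) * a ≤ 1) :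
    (1 - (l : ℝ) * a) ^ ((∑ k ∈ s, c k) / l) * (1 - ((∑ k ∈ s, c k) % l : ℕ) * a) ≤
      ∏ k ∈ s, (1 - (c k : ℝ) * a) := by
  induction s using Finset.cons_induction with
  | empty => simp
  | cons i s hi ih =>
    rw [Finset.sum_cons, Finset.prod_cons]
    refine (pow_div_mul_one_sub_mod_add_le hl (hc i) ha hla _).trans
      (mul_le_mul_of_nonneg_left ih ?_)
    have : (c i : ℝ) * a ≤ l * a :=
      mul_le_mul_of_nonneg_right (by exact_mod_cast hc i) ha
    linarith

/-- Product-minimization inequality: if `0 ≤ c_k ≤ l`, `Σ_{k=1}^R c_k = l·b + u` with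
`0 ≤ u ≤ l-1`, and `0 ≤ a ≤ 1/l`, then `∏_{k=1}^R (1 - c_k·a) ≥ (1 - l·a)^b · (1 - u·a)`. -/
theorem prod_one_sub_mul_ge
    (l R b u : ℕ) (hl : 1 ≤ l) (hR : 1 ≤ R) (hu : u ≤ l - 1)
    (c : Fin R → ℕ) (hc : ∀ k, c k ≤ l) (hsum : ∑ k, c k = l * b + u)
    (a : ℝ) (ha0 : 0 ≤ a) (ha1 : a ≤ 1 / (l : ℝ)) :
    (1 - (l : ℝ) * a) ^ b * (1 - (u : ℝ) * a) ≤ ∏ k, (1 - (c k : ℝ) * a) := by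
  have hl0 : (0 : ℝ) < l := by exact_mod_cast hl
  have hla : (l : ℝ) * a ≤ 1 := by rwa [le_div_iff₀' hl0] at ha1
  obtain ⟨hq, hm⟩ : (∑ k, c k) / l = b ∧ (∑ k, c k) % l = u :=
    (Nat.div_mod_unique hl).2 ⟨by rw [hsum, add_comm], by lia⟩
  simpa only [hq, hm] using pow_div_mul_one_sub_mod_sum_le_prod Finset.univ hl hc ha0 hla
end

section
/- Fix integers w ≥ 1, l ≥ 1, b ≥ 0 and 0 ≤ u ≤ l-1, and for real q > 1 define a_q := 1 - ∏_{h=1}^{w} (1 - q^{-h}). Then q · [1 - (1 - a_q)^{l} · (1 - l·a_q)^{b} · (1 - u·a_q)] tends to l + l·b + u as q tends to infinity. -/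
open Filter

/-- First-order deficits from `1`, rescaled by `q`, add up under multiplication. -/
theorem tendsto_mul_one_sub_mul {f g : ℝ → ℝ} {A B : ℝ}
    (hf : Tendsto (fun q => q * (1 - f q)) atTop (nhds A))
    (hg : Tendsto (fun q => q * (1 - g q)) atTop (nhds B)) :
    Tendsto (fun q => q * (1 - f q * g q)) atTop (nhds (A + B)) := by
  have h := (hf.add hg).sub ((hf.mul hg).mul tendsto_inv_atTop_zero)
  rw [mul_zero, sub_zero] at h
  refine h.congr' ?_
  filter_upwards [eventually_ne_atTop 0] with q hq
  field_simp
  ring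

theorem tendsto_mul_one_sub_prod {ι : Type*} (s : Finset ι) {f : ι → ℝ → ℝ} {A : ι → ℝ}
    (hf : ∀ i ∈ s, Tendsto (fun q => q * (1 - f i q)) atTop (nhds (A i))) :
    Tendsto (fun q => q * (1 - ∏ i ∈ s, f i q)) atTop (nhds (∑ i ∈ s, A i)) := by
  classical
  induction s using Finset.induction_on with
  | empty => simp
  | insert i s hi ih =>
    simp only [Finset.prod_insert hi, Finset.sum_insert hi]
    exact tendsto_mul_one_sub_mul (hf i (Finset.mem_insert_self i s))
      (ih fun j hj => hf j (Finset.mem_insert_of_mem hj))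

theorem tendsto_mul_one_sub_pow {f : ℝ → ℝ} {A : ℝ}
    (hf : Tendsto (fun q => q * (1 - f q)) atTop (nhds A)) (n : ℕ) :
    Tendsto (fun q => q * (1 - f q ^ n)) atTop (nhds (n * A)) := by
  simpa using tendsto_mul_one_sub_prod (Finset.range n) fun _ _ => hf

theorem tendsto_mul_inv_pow_succ (h : ℕ) :
    Tendsto (fun q : ℝ => q * (1 - (1 - (q ^ (h + 1))⁻¹))) atTop
      (nhds (if h = 0 then 1 else 0)) := by
  have key : (fun q : ℝ => (q ^ h)⁻¹) =ᶠ[atTop]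
      fun q => q * (1 - (1 - (q ^ (h + 1))⁻¹)) := by
    filter_upwards [eventually_ne_atTop 0] with q hq
    rw [sub_sub_cancel, pow_succ, mul_inv]
    field_simp
  refine Tendsto.congr' key ?_
  split_ifs with h0
  · simp [h0]
  · exact tendsto_inv_atTop_zero.comp (tendsto_pow_atTop h0)

/-- With `a_q = 1 - ∏_{h=1}^{w}(1 - q^{-h})`, for fixed `w ≥ 1`, `l ≥ 1`, `b ≥ 0` and
`0 ≤ u ≤ l-1`, the quantity `q·[1 - (1 - a_q)^l (1 - l·a_q)^b (1 - u·a_q)]` tends to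
`l + l·b + u` as `q → ∞`. -/
theorem tendsto_failure_bound_sum_internal
    (w l b u : ℕ) (hw : 1 ≤ w) (hl : 1 ≤ l) (hu : u ≤ l - 1) (a : ℝ → ℝ)
    (ha : ∀ q : ℝ, 1 < q → a q = 1 - ∏ h ∈ Finset.range w, (1 - (q ^ (h + 1))⁻¹)) :
    Tendsto
      (fun q : ℝ =>
        q * (1 - (1 - a q) ^ l * (1 - (l : ℝ) * a q) ^ b * (1 - (u : ℝ) * a q)))
      atTop (nhds ((l : ℝ) + (l : ℝ) * (b : ℝ) + (u : ℝ))) := by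
  have hqa : Tendsto (fun q => q * a q) atTop (nhds 1) := by
    have h := tendsto_mul_one_sub_prod (Finset.range w) fun h _ => tendsto_mul_inv_pow_succ h
    have hsum : ∑ h ∈ Finset.range w, (if h = 0 then (1 : ℝ) else 0) = 1 := by
      rw [Finset.sum_ite_eq', if_pos (Finset.mem_range.mpr hw)]
    rw [hsum] at h
    refine h.congr' ?_
    filter_upwards [eventually_gt_atTop 1] with q hq
    rw [ha q hq]
  have hlin (c : ℝ) : Tendsto (fun q => q * (1 - (1 - c * a q))) atTop (nhds c) := by
    simpa [mul_left_comm] using hqa.const_mul c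
  have h1 := tendsto_mul_one_sub_pow (hlin 1) l
  have h2 := tendsto_mul_one_sub_pow (hlin l) b
  simpa [mul_comm (b : ℝ)] using
    tendsto_mul_one_sub_mul (tendsto_mul_one_sub_mul h1 h2) (hlin u)
end
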